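/- (Nash equilibrium guarantee for the collaborative game with privacy, core analytical form.) Let u₁, u₂ : ℝ × ℝ → ℝ be twice continuously differentiable with equal mixed second-order partial derivatives, ∂²u₁/∂p₁∂p₂ = ∂²u₂/∂p₁∂p₂ on ℝ². Then the two-player game with action sets [0,1] and utilities u₁, u₂ has at least one pure-strategy Nash equilibrium: there exists (p₁*, p₂*) ∈ [0,1] × [0,1] such that u₁(p₁, p₂*) ≤ u₁(p₁*, p₂*) for all p₁ ∈ [0,1] and u₂(p₁*, p₂) ≤ u₂(p₁*, p₂*) for all p₂ ∈ [0,1]. -/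

import Mathlib

theorem cgp_hd (u : ℝ × ℝ → ℝ) (h : ContDiff ℝ 2 u) (x b : ℝ) :
    HasDerivAt (fun y => u (x, y)) (fderiv ℝ u (x, b) (0, 1)) b := by
  have h1 : HasFDerivAt u (fderiv ℝ u (x, b)) (x, b) :=
    ((h.differentiable (by norm_num)) (x, b)).hasFDerivAt
  have h2 : HasDerivAt (fun y : ℝ => (x, y)) ((0 : ℝ), (1 : ℝ)) b :=
    (hasDerivAt_const b x).prodMk (hasDerivAt_id b)
  exact h1.comp_hasDerivAt b h2

theorem cgp_dd (u : ℝ × ℝ → ℝ) (h : ContDiff ℝ 2 u) (b : ℝ) :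
    Differentiable ℝ (fun x => deriv (fun y => u (x, y)) b) := by
  have e : (fun x => deriv (fun y => u (x, y)) b) = fun x => fderiv ℝ u (x, b) (0, 1) := by
    funext x
    exact (cgp_hd u h x b).deriv
  rw [e]
  have h1 : Differentiable ℝ (fderiv ℝ u) :=
    (h.fderiv_right (m := 1) (by norm_num)).differentiable (by norm_num)
  have h2 : Differentiable ℝ (fun x : ℝ => fderiv ℝ u (x, b)) :=
    h1.comp (differentiable_id.prodMk (differentiable_const b))
  exact h2.clm_apply (differentiable_const _)

/-- Nash equilibrium guarantee for the collaborative game with privacy: if the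
two `C²` utility functions have equal mixed second-order partial derivatives
everywhere, then the two-player game with action sets `[0,1]` has at least one
pure-strategy Nash equilibrium. -/
theorem cgp_has_nash (u₁ u₂ : ℝ × ℝ → ℝ)
    (h₁ : ContDiff ℝ 2 u₁) (h₂ : ContDiff ℝ 2 u₂)
    (hmixed : ∀ a b : ℝ,
      deriv (fun x => deriv (fun y => u₁ (x, y)) b) a
        = deriv (fun x => deriv (fun y => u₂ (x, y)) b) a) :
    ∃ p ∈ Set.Icc (0 : ℝ) 1 ×ˢ Set.Icc (0 : ℝ) 1,
      (∀ p₁ ∈ Set.Icc (0 : ℝ) 1, u₁ (p₁, p.2) ≤ u₁ p) ∧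
      (∀ p₂ ∈ Set.Icc (0 : ℝ) 1, u₂ (p.1, p₂) ≤ u₂ p) := by
  have key1 : ∀ x b : ℝ, deriv (fun y => u₁ (x, y)) b - deriv (fun y => u₂ (x, y)) b
      = deriv (fun y => u₁ (0, y)) b - deriv (fun y => u₂ (0, y)) b := by
    intro x b
    refine is_const_of_deriv_eq_zero
      (f := fun x => deriv (fun y => u₁ (x, y)) b - deriv (fun y => u₂ (x, y)) b)
      ((cgp_dd u₁ h₁ b).sub (cgp_dd u₂ h₂ b)) (fun a => ?_) x 0
    have := ((cgp_dd u₁ h₁ b a).hasDerivAt.sub (cgp_dd u₂ h₂ b a).hasDerivAt).deriv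
    rw [hmixed a b, sub_self] at this
    exact this
  have key2 : ∀ x y : ℝ, (u₁ (x, y) - u₂ (x, y)) - (u₁ (0, y) - u₂ (0, y))
      = (u₁ (x, 0) - u₂ (x, 0)) - (u₁ (0, 0) - u₂ (0, 0)) := by
    intro x y
    have hd : ∀ b, HasDerivAt
        (fun y => (u₁ (x, y) - u₂ (x, y)) - (u₁ (0, y) - u₂ (0, y))) 0 b := by
      intro b
      have k := key1 x b
      rw [(cgp_hd u₁ h₁ x b).deriv, (cgp_hd u₂ h₂ x b).deriv, (cgp_hd u₁ h₁ 0 b).deriv,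
        (cgp_hd u₂ h₂ 0 b).deriv] at k
      have := ((cgp_hd u₁ h₁ x b).sub (cgp_hd u₂ h₂ x b)).sub
        ((cgp_hd u₁ h₁ 0 b).sub (cgp_hd u₂ h₂ 0 b))
      rw [k, sub_self] at this
      exact this
    exact is_const_of_deriv_eq_zero
      (f := fun y => (u₁ (x, y) - u₂ (x, y)) - (u₁ (0, y) - u₂ (0, y)))
      (fun b => (hd b).differentiableAt) (fun b => (hd b).deriv) y 0
  have c₁ := h₁.continuous
  have c₂ := h₂.continuous
  have hc : Continuous (fun p : ℝ × ℝ => u₁ p - (u₁ (0, p.2) - u₂ (0, p.2))) := by fun_prop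
  obtain ⟨⟨a, b⟩, hp, hmax⟩ := (isCompact_Icc.prod isCompact_Icc :
    IsCompact (Set.Icc (0 : ℝ) 1 ×ˢ Set.Icc (0 : ℝ) 1)).exists_isMaxOn
    ⟨(0, 0), by simp⟩ hc.continuousOn
  refine ⟨(a, b), hp, fun p₁ h => ?_, fun p₂ h => ?_⟩
  · have := hmax (Set.mk_mem_prod h hp.2)
    simp only [Set.mem_setOf_eq] at this
    dsimp only
    linarith
  · have := hmax (Set.mk_mem_prod hp.1 h)
    simp only [Set.mem_setOf_eq] at this
    have k1 := key2 a b
    have k2 := key2 a p₂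
    dsimp only at *
    linarith
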